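/- Let a > 0. Then lim_{u→∞} u² ∫₀¹ ∫₀¹ √(xy) · exp(a(2xy − y − x)u) dx dy = 1/a². -/

import Mathlib

open MeasureTheory Filter Set Topology

theorem integrableOn_exp_neg_mul_add {b : ℝ} (hb : 0 < b) :
    IntegrableOn (fun p : ℝ × ℝ => Real.exp (-b * p.1) * Real.exp (-b * p.2))
      (Ici 0 ×ˢ Ici 0) := by
  have h : IntegrableOn (fun x : ℝ => Real.exp (-b * x)) (Ici 0) :=
    (integrableOn_Ici_iff_integrableOn_Ioi (by simp)).2 (exp_neg_integrableOn_Ioi 0 hb)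
  rw [IntegrableOn, Measure.volume_eq_prod, ← Measure.prod_restrict]
  exact Integrable.mul_prod h h

theorem integral_exp_neg_mul_add {b : ℝ} (hb : 0 < b) :
    ∫ p in (Ici (0 : ℝ) ×ˢ Ici (0 : ℝ)), Real.exp (-b * p.1) * Real.exp (-b * p.2)
      = 1 / b ^ 2 := by
  have h : ∫ x in Ici (0 : ℝ), Real.exp (-b * x) = 1 / b := by
    rw [integral_Ici_eq_integral_Ioi, integral_exp_mul_Ioi (neg_lt_zero.2 hb) 0]
    simp
  rw [Measure.volume_eq_prod,
    setIntegral_prod_mul (fun x => Real.exp (-b * x)) (fun x => Real.exp (-b * x)), h]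
  field_simp

/-- Laplace asymptotics at the corner `0` of a triangle, for the phase `x + y - 2xy`. -/
theorem tendsto_sq_mul_integral_corner {a : ℝ} (ha : 0 < a) {g : ℝ × ℝ → ℝ}
    (hg : Continuous g) {S : Set (ℝ × ℝ)} (hS : MeasurableSet S)
    (hgS : ∀ p ∈ S, |g p| ≤ 1) (hSle : ∀ p ∈ S, 0 ≤ p.1 ∧ 0 ≤ p.2 ∧ p.1 + p.2 ≤ 1)
    (hltS : ∀ p : ℝ × ℝ, 0 ≤ p.1 → 0 ≤ p.2 → p.1 + p.2 < 1 → p ∈ S) :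
    Tendsto (fun u : ℝ => u ^ 2 *
        ∫ p in S, g p * Real.exp (a * (2 * p.1 * p.2 - p.2 - p.1) * u))
      atTop (𝓝 (g 0 * (1 / a ^ 2))) := by
  set F : ℝ → ℝ × ℝ → ℝ := fun u =>
    S.indicator fun p => g p * Real.exp (a * (2 * p.1 * p.2 - p.2 - p.1) * u) with hF
  have hscale : ∀ u : ℝ, 0 < u → ∫ p, F u (u⁻¹ • p) = u ^ 2 *
      ∫ p in S, g p * Real.exp (a * (2 * p.1 * p.2 - p.2 - p.1) * u) := by
    intro u hu
    rw [Measure.integral_comp_inv_smul_of_nonneg volume (F u) hu.le, hF, integral_indicator hS]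
    simp
  have hFm : ∀ u, Measurable (F u) := fun u =>
    Measurable.indicator (by fun_prop) hS
  set L : ℝ × ℝ → ℝ := (Ici (0 : ℝ) ×ˢ Ici (0 : ℝ)).indicator
    fun p => g 0 * (Real.exp (-a * p.1) * Real.exp (-a * p.2)) with hL
  set B : ℝ × ℝ → ℝ := (Ici (0 : ℝ) ×ˢ Ici (0 : ℝ)).indicator
    fun p => Real.exp (-(a / 2) * p.1) * Real.exp (-(a / 2) * p.2) with hB
  have hQ : MeasurableSet (Ici (0 : ℝ) ×ˢ Ici (0 : ℝ)) := measurableSet_Ici.prod measurableSet_Ici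
  have hLint : ∫ p, L p = g 0 * (1 / a ^ 2) := by
    rw [hL, integral_indicator hQ, integral_const_mul, integral_exp_neg_mul_add ha]
  rw [← hLint]
  have key : Tendsto (fun u : ℝ => ∫ p, F u (u⁻¹ • p)) atTop (𝓝 (∫ p, L p)) := by
    refine tendsto_integral_filter_of_dominated_convergence B ?_ ?_ ?_ ?_
    · exact Eventually.of_forall fun u =>
        ((hFm u).comp (measurable_const_smul u⁻¹)).aestronglyMeasurable
    · filter_upwards [eventually_gt_atTop 0] with u hu
      refine Eventually.of_forall fun p => ?_
      have hB0 : 0 ≤ B p := indicator_nonneg (fun _ _ => by positivity) p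
      by_cases hp : u⁻¹ • p ∈ S
      · obtain ⟨h1, h2, h3⟩ := hSle _ hp
        simp only [Prod.smul_fst, Prod.smul_snd, smul_eq_mul] at h1 h2 h3
        have e1 : p.1 = u * (u⁻¹ * p.1) := by field_simp
        have e2 : p.2 = u * (u⁻¹ * p.2) := by field_simp
        have hpQ : p ∈ Ici (0 : ℝ) ×ˢ Ici (0 : ℝ) := by
          constructor
          · rw [mem_Ici, e1]; positivity
          · rw [mem_Ici, e2]; positivity
        simp only [hF, hB, indicator_of_mem hp, indicator_of_mem hpQ]
        rw [norm_mul, Real.norm_eq_abs, Real.norm_eq_abs, Real.abs_exp, ← Real.exp_add]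
        refine (mul_le_of_le_one_left (Real.exp_pos _).le (hgS _ hp)).trans ?_
        rw [Real.exp_le_exp]
        simp only [Prod.smul_fst, Prod.smul_snd, smul_eq_mul]
        rw [show -(a / 2) * p.1 + -(a / 2) * p.2
          = a * (-((u⁻¹ * p.1 + u⁻¹ * p.2) / 2)) * u by field_simp; ring]
        generalize u⁻¹ * p.1 = s at *
        generalize u⁻¹ * p.2 = t at *
        gcongr
        nlinarith [sq_nonneg (s - t)]
      · simpa [hF, hp] using hB0
    · exact (integrable_indicator_iff hQ).2 (integrableOn_exp_neg_mul_add (half_pos ha))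
    · refine Eventually.of_forall fun p => ?_
      have hinv : Tendsto (fun u : ℝ => u⁻¹) atTop (𝓝 0) := tendsto_inv_atTop_zero
      by_cases hp : p ∈ Ici (0 : ℝ) ×ˢ Ici (0 : ℝ)
      · have hp1 : 0 ≤ p.1 := hp.1
        have hp2 : 0 ≤ p.2 := hp.2
        have hgl : Tendsto (fun u : ℝ => g (u⁻¹ • p)) atTop (𝓝 (g 0)) := by
          have : Tendsto (fun u : ℝ => u⁻¹ • p) atTop (𝓝 0) := by
            simpa using hinv.smul_const p
          exact (hg.tendsto 0).comp this
        have hel : Tendsto (fun u : ℝ =>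
            Real.exp (a * (2 * p.1 * p.2 * u⁻¹ - p.2 - p.1))) atTop
            (𝓝 (Real.exp (-a * p.1) * Real.exp (-a * p.2))) := by
          rw [← Real.exp_add, show -a * p.1 + -a * p.2 = a * (2 * p.1 * p.2 * 0 - p.2 - p.1) by ring]
          exact (Real.continuous_exp.tendsto _).comp
            ((((hinv.const_mul _).sub_const _).sub_const _).const_mul _)
        rw [hL, indicator_of_mem hp]
        refine (hgl.mul hel).congr' ?_
        filter_upwards [eventually_gt_atTop 0, eventually_gt_atTop (p.1 + p.2)] with u hu hpu
        have hpS : u⁻¹ • p ∈ S := by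
          refine hltS _ ?_ ?_ ?_ <;> simp only [Prod.smul_fst, Prod.smul_snd, smul_eq_mul]
          · positivity
          · positivity
          · rw [← mul_add, inv_mul_lt_iff₀ hu]; simpa using hpu
        simp only [hF, indicator_of_mem hpS, Prod.smul_fst, Prod.smul_snd, smul_eq_mul]
        congr 2
        field_simp
      · rw [hL, indicator_of_notMem hp]
        refine tendsto_const_nhds.congr' ?_
        filter_upwards [eventually_gt_atTop 0] with u hu
        have hpS : u⁻¹ • p ∉ S := by
          intro h
          obtain ⟨h1, h2, -⟩ := hSle _ h
          simp only [Prod.smul_fst, Prod.smul_snd, smul_eq_mul] at h1 h2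
          have hu' := inv_pos.2 hu
          exact hp ⟨nonneg_of_mul_nonneg_right h1 hu', nonneg_of_mul_nonneg_right h2 hu'⟩
        simp [hF, hpS]
  refine key.congr' ?_
  filter_upwards [eventually_gt_atTop 0] with u hu using hscale u hu

/-- The limit of `D_u¹` in the proof of Lemma 4.5:
`u² ∫₀¹ ∫₀¹ √(xy) exp(a(2xy - y - x) u) dx dy → 1/a²` as `u → ∞`, for `a > 0`. -/
theorem limit_D_one (a : ℝ) (ha : 0 < a) :
    Tendsto
      (fun u : ℝ => u ^ 2 *
        ∫ p in Set.Icc (0 : ℝ) 1 ×ˢ Set.Icc (0 : ℝ) 1,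
          Real.sqrt (p.1 * p.2) * Real.exp (a * (2 * p.1 * p.2 - p.2 - p.1) * u))
      atTop (𝓝 (1 / a ^ 2)) := by
  set Q : Set (ℝ × ℝ) := Icc 0 1 ×ˢ Icc 0 1 with hQdef
  have hQ : MeasurableSet Q := measurableSet_Icc.prod measurableSet_Icc
  have hH : MeasurableSet {p : ℝ × ℝ | p.1 + p.2 ≤ 1} :=
    measurableSet_le (by fun_prop) measurable_const
  have hH' : MeasurableSet {p : ℝ × ℝ | p.1 + p.2 < 1} :=
    measurableSet_lt (by fun_prop) measurable_const
  have hsqrt : ∀ x y : ℝ, 0 ≤ x → 0 ≤ y → x ≤ 1 → y ≤ 1 → |√(x * y)| ≤ 1 := by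
    intro x y hx hy hx1 hy1
    rw [abs_of_nonneg (Real.sqrt_nonneg _)]
    exact Real.sqrt_le_one.2 (mul_le_one₀ hx1 hy hy1)
  have h0 := tendsto_sq_mul_integral_corner ha (g := fun p => √(p.1 * p.2)) (by fun_prop)
    (hQ.inter hH)
    (fun p hp => hsqrt _ _ hp.1.1.1 hp.1.2.1 hp.1.1.2 hp.1.2.2)
    (fun p hp => ⟨hp.1.1.1, hp.1.2.1, hp.2⟩)
    (fun p h1 h2 h3 => ⟨⟨⟨h1, by linarith⟩, ⟨h2, by linarith⟩⟩, h3.le⟩)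
  have h1 := tendsto_sq_mul_integral_corner ha (g := fun p => √((1 - p.1) * (1 - p.2)))
    (by fun_prop) (hQ.inter hH')
    (fun p hp => hsqrt _ _ (sub_nonneg.2 hp.1.1.2) (sub_nonneg.2 hp.1.2.2)
      (sub_le_self _ hp.1.1.1) (sub_le_self _ hp.1.2.1))
    (fun p hp => ⟨hp.1.1.1, hp.1.2.1, le_of_lt hp.2⟩)
    (fun p h1 h2 h3 => ⟨⟨⟨h1, by linarith⟩, ⟨h2, by linarith⟩⟩, h3⟩)
  have hsum := h0.add h1
  simp only [Prod.fst_zero, Prod.snd_zero, mul_zero, Real.sqrt_zero, zero_mul, sub_zero, mul_one,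
    Real.sqrt_one, one_mul, zero_add] at hsum
  refine hsum.congr fun u => ?_
  set f : ℝ × ℝ → ℝ := fun p => √(p.1 * p.2) * Real.exp (a * (2 * p.1 * p.2 - p.2 - p.1) * u)
    with hf
  have hint : IntegrableOn f Q :=
    ContinuousOn.integrableOn_compact (isCompact_Icc.prod isCompact_Icc) (by fun_prop)
  have hreflect : ∫ p in Q ∩ {p : ℝ × ℝ | p.1 + p.2 < 1},
      √((1 - p.1) * (1 - p.2)) * Real.exp (a * (2 * p.1 * p.2 - p.2 - p.1) * u)
      = ∫ p in Q \ {p : ℝ × ℝ | p.1 + p.2 ≤ 1}, f p := by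
    rw [← integral_indicator (hQ.inter hH'), ← integral_indicator (hQ.diff hH),
      ← integral_sub_left_eq_self _ volume ((1, 1) : ℝ × ℝ)]
    congr 1
    ext p
    have hiff : (1, 1) - p ∈ Q ∩ {p : ℝ × ℝ | p.1 + p.2 < 1} ↔
        p ∈ Q \ {p : ℝ × ℝ | p.1 + p.2 ≤ 1} := by
      simp only [hQdef, mem_inter_iff, Set.mem_sdiff, mem_prod, mem_Icc, mem_ofPred_eq, Prod.fst_sub,
        Prod.snd_sub]
      grind
    by_cases hp : p ∈ Q \ {p : ℝ × ℝ | p.1 + p.2 ≤ 1}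
    · rw [indicator_of_mem hp, indicator_of_mem (hiff.2 hp)]
      simp only [hf, Prod.fst_sub, Prod.snd_sub]
      congr 2 <;> ring_nf
    · rw [indicator_of_notMem hp, indicator_of_notMem (mt hiff.1 hp)]
  rw [hreflect, ← mul_add, integral_inter_add_sdiff hH hint]
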